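/- Let τ be a Hopf algebra automorphism of H with τ² = Id, and let (V,ρ) be an irreducible finite-dimensional left H-module with character χ. Then ν₂(χ,τ) ≠ 0 if and only if V is isomorphic as an H-module to its twisted dual V†. -/

import Mathlib

open TensorProduct

noncomputable section

universe u

variable (k : Type u) [Field k]

/-- `twistedMulMap τ n : h ↦ Σ h₁ · τ(h₂) · ⋯ · τⁿ(h_{n+1})`, the product of the `n+1`
Sweedler factors of the iterated comultiplication with the twist `τ` applied progressively.
For `n = 1` this is `h ↦ Σ h₁ τ(h₂)`, so that the second twisted Frobenius–Schur indicator
is `ν₂(χ, τ) = χ (twistedMulMap τ 1 Λ)`. -/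
def twistedMulMap (H : Type u) [Ring H] [HopfAlgebra k H] (τ : H →ₗ[k] H) :
    ℕ → (H →ₗ[k] H)
  | 0 => LinearMap.id
  | n + 1 => LinearMap.mul' k H ∘ₗ TensorProduct.map LinearMap.id (τ ∘ₗ twistedMulMap H τ n)
      ∘ₗ Coalgebra.comul (R := k)

/-- The transpose `f ↦ fᵗ = Ψ⁻¹ ∘ f†` of maps `V† → V`, where `Ψ : V ≃ V**` is evaluation
and `f†` is the usual dual map. -/
def transposeMap (V : Type u) [AddCommGroup V] [Module k V] [FiniteDimensional k V] :
    (Module.Dual k V →ₗ[k] V) →ₗ[k] (Module.Dual k V →ₗ[k] V) :=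
  LinearMap.llcomp k (Module.Dual k V) (Module.Dual k (Module.Dual k V)) V
      (Module.evalEquiv k V).symm.toLinearMap ∘ₗ Module.Dual.transpose (R := k)

/-- The space `Hom_H(V†, V)` of `H`-module maps from the twisted dual `V†` (the dual space
of `V` with the `H`-action `(h · f)(v) = f(T(h) · v)`, `T = τ ∘ S`) to `V`. -/
def homHSub (H V : Type u) [Ring H] [HopfAlgebra k H] [AddCommGroup V] [Module k V]
    (τ : H →ₗ[k] H) (ρ : H →ₐ[k] Module.End k V) :
    Submodule k (Module.Dual k V →ₗ[k] V) where
  carrier := {f | ∀ h : H,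
    ρ h ∘ₗ f = f ∘ₗ (ρ (τ (HopfAlgebra.antipode (R := k) h))).dualMap}
  add_mem' := by
    intro f g hf hg h
    simp only [LinearMap.comp_add, LinearMap.add_comp, hf h, hg h]
  zero_mem' := by
    intro h
    simp
  smul_mem' := by
    intro c f hf h
    simp only [LinearMap.comp_smul, LinearMap.smul_comp, hf h]


section Hopf

variable {H : Type*} [Ring H] [HopfAlgebra k H]

/-- The Hopf algebra identity `Σ (S(h₁) ⊗ 1) Δ(h₂) = 1 ⊗ h`. -/
lemma sum_antipode_tmul_one_mul_comul {ι : Type*} {h : H} (r : Coalgebra.Repr k h ι) :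
    ∑ i ∈ r.index, (HopfAlgebra.antipode k (r.left i) ⊗ₜ[k] (1 : H)) *
      Coalgebra.comul (R := k) (r.right i) = 1 ⊗ₜ[k] h := by
  let F : H ⊗[k] (H ⊗[k] H) →ₗ[k] H ⊗[k] H :=
    (LinearMap.mul' k H ∘ₗ (HopfAlgebra.antipode k).rTensor H).rTensor H ∘ₗ
      (TensorProduct.assoc k H H H).symm.toLinearMap
  have hF : ∀ (a : H) (t : H ⊗[k] H),
      (HopfAlgebra.antipode k a ⊗ₜ[k] (1 : H)) * t = F (a ⊗ₜ t) := by
    intro a t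
    induction t with
    | zero => simp
    | tmul x y => simp [F]
    | add x y hx hy => rw [mul_add, TensorProduct.tmul_add, map_add, hx, hy]
  have hcoassoc : ∑ i ∈ r.index, r.left i ⊗ₜ[k] Coalgebra.comul (R := k) (r.right i) =
      TensorProduct.assoc k H H H
        ((Coalgebra.comul (R := k)).rTensor H (Coalgebra.comul (R := k) h)) := by
    rw [Coalgebra.coassoc_apply, ← r.eq, map_sum]
    rfl
  simp_rw [hF]
  rw [← map_sum, hcoassoc]
  simp only [F, LinearMap.comp_apply, LinearEquiv.coe_coe, LinearEquiv.symm_apply_apply]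
  rw [← LinearMap.rTensor_comp_apply, LinearMap.comp_assoc,
    HopfAlgebra.mul_antipode_rTensor_comul, LinearMap.rTensor_comp_apply,
    Coalgebra.rTensor_counit_comul]
  simp

variable {Λ : H}

lemma one_tmul_mul_comul_integral
    (hleft : ∀ a : H, a * Λ = Coalgebra.counit (R := k) a • Λ) (h : H) :
    ((1 : H) ⊗ₜ[k] h) * Coalgebra.comul (R := k) Λ =
      (HopfAlgebra.antipode k h ⊗ₜ[k] (1 : H)) * Coalgebra.comul (R := k) Λ := by
  let r := Coalgebra.Repr.arbitrary k h
  have hS : HopfAlgebra.antipode k h =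
      ∑ i ∈ r.index, Coalgebra.counit (R := k) (r.right i) •
        HopfAlgebra.antipode k (r.left i) := by
    have key := congrArg (TensorProduct.rid k H)
      (Coalgebra.sum_map_tmul_counit_eq (HopfAlgebra.antipode k) h (repr := r))
    rw [map_sum] at key
    simpa only [TensorProduct.rid_tmul, one_smul] using key.symm
  rw [← sum_antipode_tmul_one_mul_comul k r, Finset.sum_mul, hS, TensorProduct.sum_tmul,
    Finset.sum_mul]
  refine Finset.sum_congr rfl fun i _ => ?_
  rw [mul_assoc, ← Bialgebra.comul_mul, hleft, map_smul, mul_smul_comm, ← smul_mul_assoc,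
    TensorProduct.smul_tmul']

lemma tmul_one_mul_comul_integral
    (hleft : ∀ a : H, a * Λ = Coalgebra.counit (R := k) a • Λ)
    (hcc : TensorProduct.comm k H H (Coalgebra.comul (R := k) Λ) = Coalgebra.comul (R := k) Λ)
    (h : H) :
    (h ⊗ₜ[k] (1 : H)) * Coalgebra.comul (R := k) Λ =
      ((1 : H) ⊗ₜ[k] HopfAlgebra.antipode k h) * Coalgebra.comul (R := k) Λ := by
  have key := congrArg (Algebra.TensorProduct.comm k H H)
    (one_tmul_mul_comul_integral k hleft h)
  have hcc' : Algebra.TensorProduct.comm k H H (Coalgebra.comul (R := k) Λ) =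
    Coalgebra.comul (R := k) Λ := hcc
  simpa [map_mul, hcc'] using key

/-- A normalized two-sided integral is fixed by every multiplicative, counit-preserving
involution. -/
lemma map_integral_eq_self
    (hleft : ∀ a : H, a * Λ = Coalgebra.counit (R := k) a • Λ)
    (hright : ∀ a : H, Λ * a = Coalgebra.counit (R := k) a • Λ)
    (hone : Coalgebra.counit (R := k) Λ = 1)
    {τ : H →ₗ[k] H} (hmul : ∀ a b : H, τ (a * b) = τ a * τ b)
    (hcounit : Coalgebra.counit (R := k) ∘ₗ τ = Coalgebra.counit (R := k))
    (hsq : τ ∘ₗ τ = LinearMap.id) : τ Λ = Λ := by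
  have hc : ∀ a, Coalgebra.counit (R := k) (τ a) = Coalgebra.counit (R := k) a :=
    LinearMap.congr_fun hcounit
  have hτ : τ (τ Λ) = Λ := LinearMap.congr_fun hsq Λ
  have h1 : τ Λ * Λ = Λ := by rw [hleft, hc, hone, one_smul]
  have h2 : τ Λ * Λ = τ Λ := by
    conv_lhs => rw [← hτ, ← hmul, hτ]
    rw [hright, hc, hone, one_smul]
  rw [← h2, h1]

end Hopf

section Tensor

variable {V : Type*} [AddCommGroup V] [Module k V] [FiniteDimensional k V]

lemma trace_comm_comp_map (A B : Module.End k V) :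
    LinearMap.trace k (V ⊗[k] V) ((TensorProduct.comm k V V).toLinearMap ∘ₗ
      TensorProduct.map A B) = LinearMap.trace k V (A * B) := by
  obtain ⟨s, rfl⟩ := (dualTensorHomEquiv k V V).surjective A
  obtain ⟨t, rfl⟩ := (dualTensorHomEquiv k V V).surjective B
  induction s with
  | zero => simp
  | add x y hx hy => simp only [map_add, TensorProduct.map_add_left, LinearMap.comp_add,
      add_mul, hx, hy]
  | tmul φ v =>
    induction t with
    | zero => simp
    | add x y hx hy => simp only [map_add, TensorProduct.map_add_right, LinearMap.comp_add,
        mul_add, hx, hy]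
    | tmul ψ w =>
      have h1 : (TensorProduct.comm k V V).toLinearMap ∘ₗ TensorProduct.map
          (dualTensorHomEquiv k V V (φ ⊗ₜ v)) (dualTensorHomEquiv k V V (ψ ⊗ₜ w)) =
          ((TensorProduct.lid k k).toLinearMap ∘ₗ TensorProduct.map φ ψ).smulRight (w ⊗ₜ[k] v) := by
        ext x y
        simp [TensorProduct.smul_tmul', TensorProduct.tmul_smul, smul_smul, mul_comm]
      have h2 : (dualTensorHomEquiv k V V (φ ⊗ₜ v)) * (dualTensorHomEquiv k V V (ψ ⊗ₜ w)) =
          ψ.smulRight (φ w • v) := by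
        ext x
        simp
      rw [h1, h2, LinearMap.trace_smulRight, LinearMap.trace_smulRight]
      simp

variable (V) in
/-- The identification of `V ⊗ V` with `Hom(V*, V)` sending `v ⊗ w` to `φ ↦ φ(w) v`. -/
def tensorSquareEquivDualHom : V ⊗[k] V ≃ₗ[k] (Module.Dual k V →ₗ[k] V) :=
  TensorProduct.comm k V V ≪≫ₗ
    TensorProduct.congr (Module.evalEquiv k V) (LinearEquiv.refl k V) ≪≫ₗ
    dualTensorHomEquiv k (Module.Dual k V) V

lemma tensorSquareEquivDualHom_tmul (v w : V) (φ : Module.Dual k V) :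
    tensorSquareEquivDualHom k V (v ⊗ₜ w) φ = φ w • v := by
  simp [tensorSquareEquivDualHom]

lemma tensorSquareEquivDualHom_map (A B : Module.End k V) (E : V ⊗[k] V) :
    tensorSquareEquivDualHom k V (TensorProduct.map A B E) =
      A ∘ₗ tensorSquareEquivDualHom k V E ∘ₗ B.dualMap := by
  induction E with
  | zero => simp
  | add x y hx hy => simp only [map_add, hx, hy, LinearMap.add_comp, LinearMap.comp_add]
  | tmul v w =>
    ext φ
    simp [tensorSquareEquivDualHom_tmul]

end Tensor

section TwistedAction

variable {H V : Type*} [Ring H] [HopfAlgebra k H] [AddCommGroup V] [Module k V]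
  (τ : H →ₗ[k] H) (ρ : H →ₐ[k] Module.End k V)

/-- The action of `H ⊗ H` on `V ⊗ V` in which the second factor is twisted by `τ`. -/
def twistedTensorAction : H ⊗[k] H →ₗ[k] Module.End k (V ⊗[k] V) :=
  TensorProduct.homTensorHomMap (.id k) V V V V ∘ₗ
    TensorProduct.map ρ.toLinearMap (ρ.toLinearMap ∘ₗ τ)

@[simp]
lemma twistedTensorAction_tmul (a b : H) :
    twistedTensorAction k τ ρ (a ⊗ₜ b) = TensorProduct.map (ρ a) (ρ (τ b)) := by
  simp [twistedTensorAction]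

lemma map_comp_twistedTensorAction
    (hmul : ∀ a b : H, τ (a * b) = τ a * τ b) (a b : H) (t : H ⊗[k] H) :
    TensorProduct.map (ρ a) (ρ (τ b)) ∘ₗ twistedTensorAction k τ ρ t =
      twistedTensorAction k τ ρ ((a ⊗ₜ b) * t) := by
  induction t with
  | zero => simp
  | add x y hx hy => simp only [map_add, LinearMap.comp_add, mul_add, hx, hy]
  | tmul x y =>
    simp [hmul, Module.End.mul_eq_comp, TensorProduct.map_comp]

lemma comm_twistedTensorAction (hsq : τ ∘ₗ τ = LinearMap.id) (t : H ⊗[k] H) (E : V ⊗[k] V) :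
    TensorProduct.comm k V V (twistedTensorAction k τ ρ t E) =
      twistedTensorAction k τ ρ (TensorProduct.map τ τ (TensorProduct.comm k H H t))
        (TensorProduct.comm k V V E) := by
  induction t with
  | zero => simp
  | add x y hx hy => simp only [map_add, LinearMap.add_apply, hx, hy]
  | tmul x y =>
    have hx : τ (τ x) = x := LinearMap.congr_fun hsq x
    induction E with
    | zero => simp
    | add x y hx hy => simp only [map_add, hx, hy]
    | tmul v w => simp [hx]

lemma trace_comm_comp_twistedTensorAction [FiniteDimensional k V] (t : H ⊗[k] H) :
    LinearMap.trace k (V ⊗[k] V) ((TensorProduct.comm k V V).toLinearMap ∘ₗ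
      twistedTensorAction k τ ρ t) =
    LinearMap.trace k V (ρ (LinearMap.mul' k H (TensorProduct.map LinearMap.id τ t))) := by
  induction t with
  | zero => simp
  | add x y hx hy => simp only [map_add, LinearMap.comp_add, hx, hy]
  | tmul x y => simp [trace_comm_comp_map]

/-- The tensors in `V ⊗ V` that correspond to `H`-module maps `V† → V`. -/
def IsTwistedInvariant (E : V ⊗[k] V) : Prop :=
  ∀ h : H, TensorProduct.map (ρ h) LinearMap.id E =
    TensorProduct.map LinearMap.id (ρ (τ (HopfAlgebra.antipode k h))) E

lemma twistedTensorAction_of_isTwistedInvariant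
    (hmul : ∀ a b : H, τ (a * b) = τ a * τ b)
    {E : V ⊗[k] V} (hE : IsTwistedInvariant k τ ρ E) (t : H ⊗[k] H) :
    twistedTensorAction k τ ρ t E = TensorProduct.map LinearMap.id
      (ρ (τ (LinearMap.mul' k H ((HopfAlgebra.antipode k).lTensor H
        (TensorProduct.comm k H H t))))) E := by
  induction t with
  | zero => simp
  | add x y hx hy => simp only [map_add, LinearMap.add_apply, hx, hy, TensorProduct.map_add_right]
  | tmul x y =>
    have h1 : TensorProduct.map (ρ x) (ρ (τ y)) E =
        TensorProduct.map LinearMap.id (ρ (τ y)) (TensorProduct.map (ρ x) LinearMap.id E) := by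
      rw [← LinearMap.comp_apply, ← TensorProduct.map_comp]
      simp
    rw [twistedTensorAction_tmul, h1, hE x, ← LinearMap.comp_apply, ← TensorProduct.map_comp]
    simp [hmul, Module.End.mul_eq_comp]

variable {Λ : H}

lemma isTwistedInvariant_twistedTensorAction_integral (hone : τ 1 = 1)
    (hmul : ∀ a b : H, τ (a * b) = τ a * τ b)
    (hleft : ∀ a : H, a * Λ = Coalgebra.counit (R := k) a • Λ)
    (hcc : TensorProduct.comm k H H (Coalgebra.comul (R := k) Λ) = Coalgebra.comul (R := k) Λ)
    (E : V ⊗[k] V) :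
    IsTwistedInvariant k τ ρ (twistedTensorAction k τ ρ (Coalgebra.comul (R := k) Λ) E) := by
  intro h
  have h1 := map_comp_twistedTensorAction k τ ρ hmul h 1 (Coalgebra.comul (R := k) Λ)
  have h2 := map_comp_twistedTensorAction k τ ρ hmul 1 (HopfAlgebra.antipode k h)
    (Coalgebra.comul (R := k) Λ)
  rw [tmul_one_mul_comul_integral k hleft hcc, ← h2, hone, map_one] at h1
  exact LinearMap.congr_fun h1 E

lemma twistedTensorAction_integral_of_isTwistedInvariant (hone : τ 1 = 1)
    (hmul : ∀ a b : H, τ (a * b) = τ a * τ b)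
    (hΛ : Coalgebra.counit (R := k) Λ = 1)
    (hcc : TensorProduct.comm k H H (Coalgebra.comul (R := k) Λ) = Coalgebra.comul (R := k) Λ)
    {E : V ⊗[k] V} (hE : IsTwistedInvariant k τ ρ E) :
    twistedTensorAction k τ ρ (Coalgebra.comul (R := k) Λ) E = E := by
  rw [twistedTensorAction_of_isTwistedInvariant k τ ρ hmul hE, hcc,
    HopfAlgebra.mul_antipode_lTensor_comul_apply, hΛ, map_one, hone, map_one,
    Module.End.one_eq_id, TensorProduct.map_id, LinearMap.id_apply]

lemma isTwistedInvariant_iff [FiniteDimensional k V] (E : V ⊗[k] V) :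
    IsTwistedInvariant k τ ρ E ↔ ∀ h : H, ρ h ∘ₗ tensorSquareEquivDualHom k V E =
      tensorSquareEquivDualHom k V E ∘ₗ (ρ (τ (HopfAlgebra.antipode k h))).dualMap := by
  refine forall_congr' fun h => ?_
  rw [← (tensorSquareEquivDualHom k V).injective.eq_iff, tensorSquareEquivDualHom_map,
    tensorSquareEquivDualHom_map]
  simp

end TwistedAction

section Irreducible

variable {H V : Type*} [AddCommGroup V] [Module k V] [FiniteDimensional k V]
  {ρ : H → Module.End k V}

/-- Schur's lemma for families of endomorphisms. -/
lemma exists_eq_smul_id_of_forall_commute [IsAlgClosed k] [Nontrivial V]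
    (hirr : ∀ U : Submodule k V, (∀ (h : H) (v : V), v ∈ U → ρ h v ∈ U) → U = ⊥ ∨ U = ⊤)
    (f : Module.End k V) (hf : ∀ h, ρ h ∘ₗ f = f ∘ₗ ρ h) :
    ∃ c : k, f = c • LinearMap.id := by
  obtain ⟨c, hc⟩ := Module.End.exists_eigenvalue f
  refine ⟨c, ?_⟩
  have htop : Module.End.eigenspace f c = ⊤ := by
    refine (hirr _ fun h v hv => ?_).resolve_left hc
    rw [Module.End.mem_eigenspace_iff] at hv ⊢
    have := LinearMap.congr_fun (hf h) v
    simp only [LinearMap.comp_apply, hv, map_smul] at this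
    exact this.symm
  ext v
  have hv : v ∈ Module.End.eigenspace f c := htop ▸ Submodule.mem_top
  simpa [Module.End.mem_eigenspace_iff] using hv

/-- A nonzero intertwiner from an equidimensional module into an irreducible one is bijective. -/
lemma bijective_of_intertwining {W : Type*} [AddCommGroup W] [Module k W] [FiniteDimensional k W]
    (hdim : Module.finrank k W = Module.finrank k V)
    (hirr : ∀ U : Submodule k V, (∀ (h : H) (v : V), v ∈ U → ρ h v ∈ U) → U = ⊥ ∨ U = ⊤)
    {σ : H → Module.End k W} {f : W →ₗ[k] V} (hf : ∀ h, ρ h ∘ₗ f = f ∘ₗ σ h) (hne : f ≠ 0) :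
    Function.Bijective f := by
  have htop : LinearMap.range f = ⊤ := by
    refine (hirr _ ?_).resolve_left fun h0 => hne (LinearMap.range_eq_bot.mp h0)
    rintro h _ ⟨w, rfl⟩
    exact ⟨σ h w, (LinearMap.congr_fun (hf h) w).symm⟩
  have hsurj := LinearMap.range_eq_top.mp htop
  exact ⟨(LinearMap.injective_iff_surjective_of_finrank_eq_finrank hdim).mpr hsurj, hsurj⟩

end Irreducible

/-- **Theorem.** For an irreducible finite-dimensional module `(V, ρ)` over a finite-dimensional
semisimple Hopf algebra `H` over an algebraically closed field of characteristic `0`, and a Hopf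
algebra automorphism `τ` with `τ² = Id`, the second twisted Frobenius–Schur indicator
`ν₂(χ, τ) = Σ χ(Λ₁ τ(Λ₂))` is nonzero if and only if `V` is isomorphic, as an `H`-module, to its
twisted dual `V†` (the dual space with `H`-action `(h · f)(v) = f(τ(S(h)) · v)`). -/
theorem twisted_second_FS_indicator_ne_zero_iff_selfdual
    (H V : Type u) [Ring H] [HopfAlgebra k H]
    [IsAlgClosed k] [CharZero k] [FiniteDimensional k H] [IsSemisimpleRing H]
    [AddCommGroup V] [Module k V] [FiniteDimensional k V]
    (Λ : H)
    (hΛleft : ∀ a : H, a * Λ = Coalgebra.counit (R := k) a • Λ)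
    (hΛright : ∀ a : H, Λ * a = Coalgebra.counit (R := k) a • Λ)
    (hΛone : Coalgebra.counit (R := k) Λ = 1)
    (hΛcc : TensorProduct.comm k H H (Coalgebra.comul (R := k) Λ) = Coalgebra.comul (R := k) Λ)
    (τ : H →ₗ[k] H)
    (hτmul : ∀ a b : H, τ (a * b) = τ a * τ b) (hτone : τ 1 = 1)
    (hτcomul : Coalgebra.comul (R := k) ∘ₗ τ =
      TensorProduct.map τ τ ∘ₗ Coalgebra.comul (R := k))
    (hτcounit : Coalgebra.counit (R := k) ∘ₗ τ = Coalgebra.counit (R := k))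
    (hτsq : τ ∘ₗ τ = LinearMap.id)
    (ρ : H →ₐ[k] Module.End k V)
    [Nontrivial V]
    (hirr : ∀ U : Submodule k V, (∀ (h : H) (v : V), v ∈ U → ρ h v ∈ U) → U = ⊥ ∨ U = ⊤) :
    LinearMap.trace k V (ρ (twistedMulMap k H τ 1 Λ)) ≠ 0 ↔
      ∃ e : Module.Dual k V ≃ₗ[k] V, ∀ h : H,
        ρ h ∘ₗ (e : Module.Dual k V →ₗ[k] V) =
          (e : Module.Dual k V →ₗ[k] V) ∘ₗ
            (ρ (τ (HopfAlgebra.antipode (R := k) h))).dualMap := by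
  set P := twistedTensorAction k τ ρ (Coalgebra.comul (R := k) Λ) with hP
  have hPinv : ∀ E, IsTwistedInvariant k τ ρ (P E) :=
    isTwistedInvariant_twistedTensorAction_integral k τ ρ hτone hτmul hΛleft hΛcc
  have htrace : LinearMap.trace k V (ρ (twistedMulMap k H τ 1 Λ)) =
      LinearMap.trace k (V ⊗[k] V) ((TensorProduct.comm k V V).toLinearMap ∘ₗ P) := by
    rw [hP, trace_comm_comp_twistedTensorAction]
    rfl
  rw [htrace]
  constructor
  · intro hne
    obtain ⟨E, hE⟩ : ∃ E, P E ≠ 0 := by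
      by_contra! hzero
      rw [LinearMap.ext (f := P) (g := 0) hzero] at hne
      simp at hne
    have hinter := (isTwistedInvariant_iff k τ ρ _).mp (hPinv E)
    exact ⟨LinearEquiv.ofBijective _ (bijective_of_intertwining k Subspace.dual_finrank_eq hirr
      hinter ((tensorSquareEquivDualHom k V).map_ne_zero_iff.mpr hE)), hinter⟩
  · rintro ⟨e, he⟩
    set E₀ := (tensorSquareEquivDualHom k V).symm e.toLinearMap with hE₀
    have hΘ : tensorSquareEquivDualHom k V E₀ = e.toLinearMap := by simp [hE₀]
    have hE₀inv : IsTwistedInvariant k τ ρ E₀ := by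
      rw [isTwistedInvariant_iff, hΘ]
      exact he
    have hPE₀ : P E₀ = E₀ :=
      twistedTensorAction_integral_of_isTwistedInvariant k τ ρ hτone hτmul hΛone hΛcc hE₀inv
    have hE₀ne : E₀ ≠ 0 := by
      intro h0
      obtain ⟨v, hv⟩ := exists_ne (0 : V)
      refine hv ?_
      have h1 := LinearMap.congr_fun hΘ (e.symm v)
      simpa [h0] using h1.symm
    have hspan : ∀ E, IsTwistedInvariant k τ ρ E → ∃ c : k, E = c • E₀ := by
      intro E hE
      rw [isTwistedInvariant_iff] at hE
      obtain ⟨c, hc⟩ := exists_eq_smul_id_of_forall_commute k hirr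
        (tensorSquareEquivDualHom k V E ∘ₗ e.symm.toLinearMap) fun h => by
          ext v
          have h1 := LinearMap.congr_fun (hE h) (e.symm v)
          have h2 := LinearMap.congr_fun (he h) (e.symm v)
          simp only [LinearMap.comp_apply, LinearEquiv.coe_coe, LinearEquiv.apply_symm_apply]
            at h1 h2 ⊢
          rw [h1, h2, LinearEquiv.symm_apply_apply]
      refine ⟨c, (tensorSquareEquivDualHom k V).injective ?_⟩
      rw [map_smul, hΘ]
      ext φ
      simpa using LinearMap.congr_fun hc (e φ)
    have hττ : TensorProduct.map τ τ (Coalgebra.comul (R := k) Λ) =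
        Coalgebra.comul (R := k) Λ := by
      rw [← LinearMap.comp_apply, ← hτcomul, LinearMap.comp_apply,
        map_integral_eq_self k hΛleft hΛright hΛone hτmul hτcounit hτsq]
    have hcommP : ∀ E, TensorProduct.comm k V V (P E) = P (TensorProduct.comm k V V E) := by
      intro E
      rw [hP, comm_twistedTensorAction k τ ρ hτsq, hΛcc, hττ]
    obtain ⟨c, hc⟩ := hspan (TensorProduct.comm k V V E₀) <| by
      rw [← hPE₀, hcommP]
      exact hPinv _
    choose φ hφ using fun E => hspan (P E) (hPinv E)
    let ψ : V ⊗[k] V →ₗ[k] k :=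
      { toFun := φ
        map_add' := fun x y => smul_left_injective k hE₀ne <| by
          simp only [add_smul, ← hφ, map_add]
        map_smul' := fun a x => smul_left_injective k hE₀ne <| by
          simp only [smul_eq_mul, RingHom.id_apply, mul_smul, ← hφ, map_smul] }
    have hrank : (TensorProduct.comm k V V).toLinearMap ∘ₗ P = ψ.smulRight (c • E₀) := by
      refine LinearMap.ext fun E => ?_
      rw [LinearMap.comp_apply, hφ E, LinearEquiv.coe_coe, map_smul, hc]
      rfl
    have hψ : ψ E₀ = 1 := smul_left_injective k hE₀ne <| by
      change φ E₀ • E₀ = (1 : k) • E₀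
      rw [← hφ, hPE₀, one_smul]
    rw [hrank, LinearMap.trace_smulRight, map_smul, hψ, smul_eq_mul, mul_one]
    rintro rfl
    rw [zero_smul] at hc
    exact hE₀ne ((TensorProduct.comm k V V).map_eq_zero_iff.mp hc)

end
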